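/- arXiv:1311.0118 — 2 statements merged into one kernel-verified Lean document; each statement's English description precedes it below -/
import Mathlib

section
/- Let (Ω, 𝒜) be a measurable space with a filtration (ℱ_t)_{t ∈ ℝ≥0}, and let S : ℝ≥0 → Ω → ℝ be a stochastic process. Fix a riskless rate r ∈ ℝ and two dividend rates a₁, a₂ ∈ ℝ with a₁ ≠ a₂. Suppose Q₁ and Q₂ are probability measures on (Ω, 𝒜) such that the discounted process t ↦ (fun ω => Real.exp (-(r + a₁) * t) * S t ω) is a martingale with respect to (ℱ_t) under Q₁, the discounted process t ↦ (fun ω => Real.exp (-(r + a₂) * t) * S t ω) is a martingale with respect to (ℱ_t) under Q₂, S t is integrable under both measures for every t, and the expectation of S 0 under Q₁ is nonzero. Then Q₁ ≠ Q₂. (This is the paper's Theorem 1: market participants with different idiosyncratic dividends for the same stock have distinct risk-neutral measures, hence no common market-wide risk-neutral measure.) -/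
open MeasureTheory
open scoped NNReal

/-- The expectation of a martingale on a finite measure space is constant in time. -/
theorem martingale_integral_eq {Ω ι E : Type*} [Preorder ι] [NormedAddCommGroup E]
    [NormedSpace ℝ E] [CompleteSpace E] {m : MeasurableSpace Ω} {μ : Measure Ω}
    [IsFiniteMeasure μ] {ℱ : Filtration ι m} {M : ι → Ω → E} (hM : Martingale M ℱ μ)
    {i j : ι} (hij : i ≤ j) : ∫ ω, M i ω ∂μ = ∫ ω, M j ω ∂μ := by
  simpa using hM.setIntegral_eq hij MeasurableSet.univ

/-- If the discounted process `exp (c * t) * S t` is a martingale, then the expectation of `S 0`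
is the discounted expectation of `S t`. -/
theorem integral_zero_eq_exp_mul_integral {Ω : Type*} {m : MeasurableSpace Ω} {μ : Measure Ω}
    [IsFiniteMeasure μ] {ℱ : Filtration ℝ≥0 m} {S : ℝ≥0 → Ω → ℝ} {c : ℝ}
    (hM : Martingale (fun (t : ℝ≥0) => fun ω => Real.exp (c * (t : ℝ)) * S t ω) ℱ μ) (t : ℝ≥0) :
    ∫ ω, S 0 ω ∂μ = Real.exp (c * (t : ℝ)) * ∫ ω, S t ω ∂μ := by
  simpa [integral_const_mul] using martingale_integral_eq hM (zero_le : 0 ≤ t)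

/-- Theorem 1 of the paper: two market participants with different idiosyncratic
dividends `a₁ ≠ a₂` for the same stock `S` have distinct risk-neutral measures,
hence there is no common market-wide risk-neutral measure. -/
theorem no_common_risk_neutral_measure
    {Ω : Type*} {m : MeasurableSpace Ω} (ℱ : Filtration ℝ≥0 m)
    (S : ℝ≥0 → Ω → ℝ) (r a₁ a₂ : ℝ) (ha : a₁ ≠ a₂)
    (Q₁ Q₂ : Measure Ω) [IsProbabilityMeasure Q₁] [IsProbabilityMeasure Q₂]
    (hM₁ : Martingale (fun (t : ℝ≥0) => fun ω => Real.exp (-(r + a₁) * (t : ℝ)) * S t ω) ℱ Q₁)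
    (hM₂ : Martingale (fun (t : ℝ≥0) => fun ω => Real.exp (-(r + a₂) * (t : ℝ)) * S t ω) ℱ Q₂)
    (hInt₁ : ∀ t, Integrable (S t) Q₁) (hInt₂ : ∀ t, Integrable (S t) Q₂)
    (h0 : ∫ ω, S 0 ω ∂Q₁ ≠ 0) :
    Q₁ ≠ Q₂ := by
  rintro rfl
  have h₁ := integral_zero_eq_exp_mul_integral hM₁ 1
  have h₂ := integral_zero_eq_exp_mul_integral hM₂ 1
  have hS : ∫ ω, S 1 ω ∂Q₁ ≠ 0 := fun h => h0 (by rw [h₁, h, mul_zero])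
  have hexp := Real.exp_injective (mul_right_cancel₀ hS (h₁.symm.trans h₂))
  refine ha ?_
  simpa using hexp
end

section
/- Let (Ω, 𝒜) be a measurable space with a filtration (ℱ_t)_{t ∈ ℝ≥0}, let Q be a probability measure on (Ω, 𝒜), and let S : ℝ≥0 → Ω → ℝ be a process with each S t integrable under Q. Fix r ∈ ℝ and a₁, a₂ ∈ ℝ with a₁ ≠ a₂, and suppose the expectation of S 0 under Q is nonzero. Then it is not the case that both t ↦ (fun ω => Real.exp (-(r + a₁) * t) * S t ω) and t ↦ (fun ω => Real.exp (-(r + a₂) * t) * S t ω) are martingales with respect to (ℱ_t) under Q. (Nonexistence of a single risk-neutral measure serving two participants with different dividends; the core of the paper's Theorem 1.) -/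
open MeasureTheory
open scoped NNReal

/-- A martingale has constant expectation. -/
theorem MeasureTheory.Martingale.integral_eq_integral_of_le
    {Ω ι E : Type*} [Preorder ι] [NormedAddCommGroup E] [NormedSpace ℝ E] [CompleteSpace E]
    {m : MeasurableSpace Ω} {μ : Measure Ω} {ℱ : Filtration ι m} [SigmaFiniteFiltration μ ℱ]
    {f : ι → Ω → E} (hf : Martingale f ℱ μ) {i j : ι} (hij : i ≤ j) :
    ∫ ω, f i ω ∂μ = ∫ ω, f j ω ∂μ := by
  simpa using hf.setIntegral_eq hij MeasurableSet.univ

/-- Core of the paper's Theorem 1: a single probability measure `Q` cannot be a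
risk-neutral measure for two participants with different dividends `a₁ ≠ a₂`. -/
theorem no_single_risk_neutral_measure_for_two_dividends
    {Ω : Type*} {m : MeasurableSpace Ω} (ℱ : Filtration ℝ≥0 m)
    (Q : Measure Ω) [IsProbabilityMeasure Q]
    (S : ℝ≥0 → Ω → ℝ) (hInt : ∀ t, Integrable (S t) Q)
    (r a₁ a₂ : ℝ) (ha : a₁ ≠ a₂)
    (h0 : ∫ ω, S 0 ω ∂Q ≠ 0) :
    ¬ (Martingale (fun (t : ℝ≥0) => fun ω => Real.exp (-(r + a₁) * (t : ℝ)) * S t ω) ℱ Q ∧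
       Martingale (fun (t : ℝ≥0) => fun ω => Real.exp (-(r + a₂) * (t : ℝ)) * S t ω) ℱ Q) := by
  rintro ⟨h₁, h₂⟩
  have e₁ := h₁.integral_eq_integral_of_le (zero_le_one (α := ℝ≥0))
  have e₂ := h₂.integral_eq_integral_of_le (zero_le_one (α := ℝ≥0))
  simp only [integral_const_mul, NNReal.coe_zero, NNReal.coe_one, mul_zero, mul_one,
    Real.exp_zero, one_mul] at e₁ e₂
  have hS : ∫ ω, S 1 ω ∂Q ≠ 0 := fun h => h0 (by rw [e₁, h, mul_zero])
  have h_exp := Real.exp_injective (mul_right_cancel₀ hS (e₁.symm.trans e₂))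
  exact ha (by linarith)
end
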